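/- arXiv:2404.08457 — 3 statements merged into one kernel-verified Lean document; each statement's English description precedes it below -/
import Mathlib

section
/- Fix c₁, c₂ ∈ ℝ. Define ℓ(c₁, c₂; 1) = 1 - Φ(max(c₁, c₂)) and ℓ(c₁, c₂; -1) = 1 - Φ(c₁) - Φ(c₂) if c₁ + c₂ ≤ 0 and ℓ(c₁, c₂; -1) = 0 otherwise. Then for every σ ∈ (-1,1), the strict inequalities ℓ(c₁, c₂; -1) < ℓ(c₁, c₂; σ) < ℓ(c₁, c₂; 1) hold; in particular σ ↦ ℓ(c₁, c₂; σ) is a strictly increasing function on (-1,1). -/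
open MeasureTheory Real

/-- The standard normal probability density function. -/
noncomputable def stdPdf (x : ℝ) : ℝ := (Real.sqrt (2 * Real.pi))⁻¹ * Real.exp (-(x ^ 2) / 2)

/-- The standard normal cumulative distribution function. -/
noncomputable def stdCdf (x : ℝ) : ℝ := ∫ t in Set.Iic x, stdPdf t

/-- The upper bivariate normal tail probability for correlation `σ ∈ (-1,1)`. -/
noncomputable def biTail (c₁ c₂ σ : ℝ) : ℝ :=
  (2 * Real.pi * Real.sqrt (1 - σ ^ 2))⁻¹ *
    ∫ x in Set.Ioi c₁, ∫ y in Set.Ioi c₂,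
      Real.exp (-(x ^ 2 + y ^ 2 - 2 * σ * x * y) / (2 * (1 - σ ^ 2)))

/-- `ℓ(c₁, c₂; 1) = 1 - Φ(max(c₁, c₂))`. -/
noncomputable def biTailOne (c₁ c₂ : ℝ) : ℝ := 1 - stdCdf (max c₁ c₂)

/-- `ℓ(c₁, c₂; -1) = 1 - Φ(c₁) - Φ(c₂)` if `c₁ + c₂ ≤ 0`, and `0` otherwise. -/
noncomputable def biTailNegOne (c₁ c₂ : ℝ) : ℝ :=
  if c₁ + c₂ ≤ 0 then 1 - stdCdf c₁ - stdCdf c₂ else 0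

/-- The standard normal upper tail function `1 - Φ`. -/
noncomputable def stdTail (u : ℝ) : ℝ := ∫ t in Set.Ioi u, stdPdf t

/-- The density at `x` of the first coordinate of a standard bivariate normal vector with
correlation `σ`, restricted to the event that the second coordinate exceeds `c`. -/
noncomputable def tailDensity (c σ x : ℝ) : ℝ :=
  stdPdf x * stdTail ((c - σ * x) / √(1 - σ ^ 2))

/-- The standard bivariate normal density, as a marginal times a conditional density. -/
noncomputable def biPdf (σ x y : ℝ) : ℝ :=
  stdPdf x * ((√(1 - σ ^ 2))⁻¹ * stdPdf ((y - σ * x) / √(1 - σ ^ 2)))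

lemma stdPdf_eq_gaussianPDFReal : stdPdf = ProbabilityTheory.gaussianPDFReal 0 1 := by
  ext x
  simp [stdPdf, ProbabilityTheory.gaussianPDFReal]

lemma stdPdf_pos (x : ℝ) : 0 < stdPdf x := by
  unfold stdPdf
  positivity

lemma stdPdf_neg (x : ℝ) : stdPdf (-x) = stdPdf x := by
  simp [stdPdf]

lemma continuous_stdPdf : Continuous stdPdf := by
  unfold stdPdf
  fun_prop

lemma integrable_stdPdf : Integrable stdPdf := by
  rw [stdPdf_eq_gaussianPDFReal]
  exact ProbabilityTheory.integrable_gaussianPDFReal 0 1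

lemma integral_stdPdf : ∫ x, stdPdf x = 1 := by
  rw [stdPdf_eq_gaussianPDFReal]
  exact ProbabilityTheory.integral_gaussianPDFReal_eq_one 0 one_ne_zero

lemma setIntegral_pos_of_pos {d : ℝ → ℝ} {s : Set ℝ} (hs : MeasurableSet s)
    (hvol : 0 < volume s) (hd : IntegrableOn d s) (hpos : ∀ x ∈ s, 0 < d x) :
    0 < ∫ x in s, d x := by
  rw [setIntegral_pos_iff_support_of_nonneg_ae
    (ae_restrict_of_forall_mem hs fun x hx => (hpos x hx).le) hd]
  have hsub : s ⊆ Function.support d := fun x hx => (hpos x hx).ne'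
  rwa [Set.inter_eq_right.2 hsub]

/-- If two integrable functions have the same integral and cross exactly once, then their upper
tail integrals are strictly ordered. -/
lemma setIntegral_Ioi_lt_of_single_crossing {f g : ℝ → ℝ} (hf : Integrable f) (hg : Integrable g)
    (hfg : ∫ x, f x = ∫ x, g x) {a : ℝ} (hlt : ∀ x, a < x → f x < g x)
    (hgt : ∀ x, x < a → g x < f x) (c : ℝ) :
    ∫ x in Set.Ioi c, f x < ∫ x in Set.Ioi c, g x := by
  rcases le_or_gt a c with hac | hca
  · have h := setIntegral_pos_of_pos (d := fun x => g x - f x) (s := Set.Ioi c)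
      measurableSet_Ioi (by simp) (hg.sub hf).integrableOn
      fun x hx => sub_pos.2 (hlt x (hac.trans_lt hx))
    rw [integral_sub hg.integrableOn hf.integrableOn] at h
    linarith
  · have h := setIntegral_pos_of_pos (d := fun x => f x - g x) (s := Set.Iic c)
      measurableSet_Iic (by simp) (hf.sub hg).integrableOn
      fun x hx => sub_pos.2 (hgt x (lt_of_le_of_lt hx hca))
    rw [integral_sub hf.integrableOn hg.integrableOn] at h
    have h1 := intervalIntegral.integral_Iic_add_Ioi (b := c) hf.integrableOn hf.integrableOn
    have h2 := intervalIntegral.integral_Iic_add_Ioi (b := c) hg.integrableOn hg.integrableOn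
    linarith

lemma stdCdf_add_stdTail (u : ℝ) : stdCdf u + stdTail u = 1 := by
  rw [← integral_stdPdf]
  exact intervalIntegral.integral_Iic_add_Ioi integrable_stdPdf.integrableOn
    integrable_stdPdf.integrableOn

lemma stdTail_pos (u : ℝ) : 0 < stdTail u :=
  setIntegral_pos_of_pos measurableSet_Ioi (by simp) integrable_stdPdf.integrableOn
    fun x _ => stdPdf_pos x

lemma stdCdf_pos (u : ℝ) : 0 < stdCdf u :=
  setIntegral_pos_of_pos measurableSet_Iic (by simp) integrable_stdPdf.integrableOn
    fun x _ => stdPdf_pos x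

lemma stdTail_lt_one (u : ℝ) : stdTail u < 1 := by
  linarith [stdCdf_add_stdTail u, stdCdf_pos u]

lemma stdTail_neg (u : ℝ) : stdTail (-u) = stdCdf u := by
  have h := integral_comp_neg_Iic u stdPdf
  simp only [stdPdf_neg] at h
  exact h.symm

lemma strictAnti_stdTail : StrictAnti stdTail := by
  intro u v huv
  have hpos : 0 < ∫ x in Set.Ioc u v, stdPdf x :=
    setIntegral_pos_of_pos measurableSet_Ioc (by simpa using huv)
      integrable_stdPdf.integrableOn fun x _ => stdPdf_pos x
  have h := setIntegral_union (f := stdPdf) (μ := volume)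
    (Set.Ioc_disjoint_Ioi_same (a := u) (b := v))
    measurableSet_Ioi integrable_stdPdf.integrableOn integrable_stdPdf.integrableOn
  rw [Set.Ioc_union_Ioi_eq_Ioi huv.le] at h
  unfold stdTail
  linarith

lemma one_sub_sq_pos {σ : ℝ} (hσ : σ ∈ Set.Ioo (-1 : ℝ) 1) : 0 < 1 - σ ^ 2 := by
  nlinarith [hσ.1, hσ.2]

lemma biPdf_eq {σ : ℝ} (hσ : σ ∈ Set.Ioo (-1 : ℝ) 1) (x y : ℝ) :
    biPdf σ x y = (2 * π * √(1 - σ ^ 2))⁻¹ *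
      rexp (-(x ^ 2 + y ^ 2 - 2 * σ * x * y) / (2 * (1 - σ ^ 2))) := by
  have hs := one_sub_sq_pos hσ
  have hexp : -(x ^ 2 + y ^ 2 - 2 * σ * x * y) / (2 * (1 - σ ^ 2)) =
      -(x ^ 2) / 2 + -(((y - σ * x) / √(1 - σ ^ 2)) ^ 2) / 2 := by
    rw [div_pow, sq_sqrt hs.le]
    field_simp
    ring
  have hpi : (2 * π * √(1 - σ ^ 2))⁻¹ =
      (√(2 * π))⁻¹ * ((√(1 - σ ^ 2))⁻¹ * (√(2 * π))⁻¹) := by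
    nth_rewrite 1 [← mul_self_sqrt (show 0 ≤ 2 * π by positivity)]
    simp only [mul_inv]
    ring
  rw [hexp, exp_add, hpi]
  unfold biPdf stdPdf
  ring

lemma biPdf_comm {σ : ℝ} (hσ : σ ∈ Set.Ioo (-1 : ℝ) 1) (x y : ℝ) :
    biPdf σ x y = biPdf σ y x := by
  rw [biPdf_eq hσ, biPdf_eq hσ]
  ring_nf

lemma biPdf_nonneg (σ x y : ℝ) : 0 ≤ biPdf σ x y := by
  have := stdPdf_pos x
  have := stdPdf_pos ((y - σ * x) / √(1 - σ ^ 2))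
  unfold biPdf
  positivity

lemma integral_inv_mul_stdPdf {s : ℝ} (hs : 0 < s) (m : ℝ) :
    ∫ y, s⁻¹ * stdPdf ((y - m) / s) = 1 := by
  rw [integral_const_mul, integral_sub_right_eq_self (fun y => stdPdf (y / s)) m,
    Measure.integral_comp_div, integral_stdPdf, abs_of_pos hs]
  simp [hs.ne']

lemma setIntegral_Ioi_inv_mul_stdPdf {s : ℝ} (hs : 0 < s) (m c : ℝ) :
    ∫ y in Set.Ioi c, s⁻¹ * stdPdf ((y - m) / s) = stdTail ((c - m) / s) := by
  rw [integral_const_mul]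
  have hshift := (measurePreserving_sub_right volume m).setIntegral_preimage_emb
    (measurableEmbedding_subRight m) (fun y => stdPdf (y / s)) (Set.Ioi (c - m))
  have hpre : (fun y => y - m) ⁻¹' Set.Ioi (c - m) = Set.Ioi c := by
    ext; simp
  have hscale := integral_comp_mul_left_Ioi stdPdf (c - m) (inv_pos.2 hs)
  rw [hpre] at hshift
  rw [hshift]
  simp only [div_eq_inv_mul]
  rw [hscale, inv_inv, smul_eq_mul, inv_mul_cancel_left₀ hs.ne']
  rfl

lemma integrable_biPdf_right {σ : ℝ} (hσ : σ ∈ Set.Ioo (-1 : ℝ) 1) (x : ℝ) :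
    Integrable (biPdf σ x) := by
  have hs : 0 < √(1 - σ ^ 2) := sqrt_pos.2 (one_sub_sq_pos hσ)
  exact (((integrable_stdPdf.comp_div hs.ne').comp_sub_right (σ * x)).const_mul _).const_mul _

lemma integral_biPdf_right {σ : ℝ} (hσ : σ ∈ Set.Ioo (-1 : ℝ) 1) (x : ℝ) :
    ∫ y, biPdf σ x y = stdPdf x := by
  have hs : 0 < √(1 - σ ^ 2) := sqrt_pos.2 (one_sub_sq_pos hσ)
  unfold biPdf
  rw [integral_const_mul, integral_inv_mul_stdPdf hs, mul_one]

lemma setIntegral_Ioi_biPdf_right {σ : ℝ} (hσ : σ ∈ Set.Ioo (-1 : ℝ) 1) (c x : ℝ) :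
    ∫ y in Set.Ioi c, biPdf σ x y = tailDensity c σ x := by
  have hs : 0 < √(1 - σ ^ 2) := sqrt_pos.2 (one_sub_sq_pos hσ)
  unfold biPdf tailDensity
  rw [integral_const_mul, setIntegral_Ioi_inv_mul_stdPdf hs]

lemma integrable_biPdf {σ : ℝ} (hσ : σ ∈ Set.Ioo (-1 : ℝ) 1) :
    Integrable (Function.uncurry (biPdf σ)) (volume.prod volume) := by
  have hcont : Continuous (Function.uncurry (biPdf σ)) := by
    unfold biPdf Function.uncurry
    have := continuous_stdPdf
    fun_prop
  rw [integrable_prod_iff hcont.aestronglyMeasurable]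
  refine ⟨ae_of_all _ fun x => integrable_biPdf_right hσ x, ?_⟩
  simp only [Function.uncurry_apply_pair, norm_of_nonneg (biPdf_nonneg σ _ _),
    integral_biPdf_right hσ]
  exact integrable_stdPdf

lemma integrable_biPdf_restrict {σ : ℝ} (hσ : σ ∈ Set.Ioo (-1 : ℝ) 1) (c : ℝ) :
    Integrable (Function.uncurry (biPdf σ)) (volume.prod (volume.restrict (Set.Ioi c))) := by
  refine (integrable_biPdf hσ).mono_measure ?_
  exact Measure.prod_mono le_rfl Measure.restrict_le_self

lemma integrable_tailDensity {σ : ℝ} (hσ : σ ∈ Set.Ioo (-1 : ℝ) 1) (c : ℝ) :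
    Integrable (tailDensity c σ) := by
  have h := (integrable_biPdf_restrict hσ c).integral_prod_left
  simpa only [Function.uncurry_apply_pair, setIntegral_Ioi_biPdf_right hσ] using h

lemma integral_tailDensity {σ : ℝ} (hσ : σ ∈ Set.Ioo (-1 : ℝ) 1) (c : ℝ) :
    ∫ x, tailDensity c σ x = stdTail c := by
  have h := integral_integral_swap (integrable_biPdf_restrict hσ c)
  simp only [setIntegral_Ioi_biPdf_right hσ] at h
  rw [h, stdTail]
  refine setIntegral_congr_fun measurableSet_Ioi fun y _ => ?_
  simp only [fun x => biPdf_comm hσ x y, integral_biPdf_right hσ]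

lemma biTail_eq {σ : ℝ} (hσ : σ ∈ Set.Ioo (-1 : ℝ) 1) (c₁ c₂ : ℝ) :
    biTail c₁ c₂ σ = ∫ x in Set.Ioi c₁, tailDensity c₂ σ x := by
  simp only [← setIntegral_Ioi_biPdf_right hσ, biPdf_eq hσ, integral_const_mul]
  rfl

lemma biTailOne_eq (c₁ c₂ : ℝ) :
    biTailOne c₁ c₂ = ∫ x in Set.Ioi c₁, (Set.Ioi c₂).indicator stdPdf x := by
  rw [setIntegral_indicator measurableSet_Ioi, Set.Ioi_inter_Ioi]
  unfold biTailOne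
  linarith [stdCdf_add_stdTail (max c₁ c₂), show stdTail (max c₁ c₂) =
    ∫ x in Set.Ioi (max c₁ c₂), stdPdf x from rfl]

lemma biTailNegOne_eq (c₁ c₂ : ℝ) :
    biTailNegOne c₁ c₂ = ∫ x in Set.Ioi c₁, (Set.Iic (-c₂)).indicator stdPdf x := by
  rw [setIntegral_indicator measurableSet_Iic, Set.Ioi_inter_Iic]
  unfold biTailNegOne
  split_ifs with h
  · rw [← intervalIntegral.integral_of_le (by linarith),
      ← intervalIntegral.integral_Iic_sub_Iic integrable_stdPdf.integrableOn
        integrable_stdPdf.integrableOn]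
    change _ = stdCdf (-c₂) - stdCdf c₁
    rw [← stdTail_neg (-c₂), neg_neg]
    linarith [stdCdf_add_stdTail c₂]
  · rw [Set.Ioc_eq_empty (by linarith)]
    simp

lemma tailDensity_lt_stdPdf (c σ x : ℝ) : tailDensity c σ x < stdPdf x :=
  mul_lt_of_lt_one_right (stdPdf_pos x) (stdTail_lt_one _)

lemma tailDensity_pos (c σ x : ℝ) : 0 < tailDensity c σ x :=
  mul_pos (stdPdf_pos x) (stdTail_pos _)

lemma biTail_lt_biTailOne {σ : ℝ} (hσ : σ ∈ Set.Ioo (-1 : ℝ) 1) (c₁ c₂ : ℝ) :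
    biTail c₁ c₂ σ < biTailOne c₁ c₂ := by
  rw [biTail_eq hσ, biTailOne_eq]
  refine setIntegral_Ioi_lt_of_single_crossing (a := c₂) (integrable_tailDensity hσ c₂)
    (integrable_stdPdf.indicator measurableSet_Ioi) ?_ (fun x hx => ?_) (fun x hx => ?_) c₁
  · rw [integral_tailDensity hσ, integral_indicator measurableSet_Ioi, stdTail]
  · rw [Set.indicator_of_mem (Set.mem_Ioi.2 hx)]
    exact tailDensity_lt_stdPdf c₂ σ x
  · rw [Set.indicator_of_notMem (Set.notMem_Ioi.2 hx.le)]
    exact tailDensity_pos c₂ σ x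

lemma biTailNegOne_lt_biTail {σ : ℝ} (hσ : σ ∈ Set.Ioo (-1 : ℝ) 1) (c₁ c₂ : ℝ) :
    biTailNegOne c₁ c₂ < biTail c₁ c₂ σ := by
  rw [biTail_eq hσ, biTailNegOne_eq]
  refine setIntegral_Ioi_lt_of_single_crossing (a := -c₂)
    (integrable_stdPdf.indicator measurableSet_Iic) (integrable_tailDensity hσ c₂)
    ?_ (fun x hx => ?_) (fun x hx => ?_) c₁
  · rw [integral_tailDensity hσ, integral_indicator measurableSet_Iic, ← neg_neg c₂,
      stdTail_neg, neg_neg, stdCdf]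
  · rw [Set.indicator_of_notMem (Set.notMem_Iic.2 hx)]
    exact tailDensity_pos c₂ σ x
  · rw [Set.indicator_of_mem (Set.mem_Iic.2 hx.le)]
    exact tailDensity_lt_stdPdf c₂ σ x

lemma strictMonoOn_div_sqrt_one_sub_sq :
    StrictMonoOn (fun σ : ℝ => σ / √(1 - σ ^ 2)) (Set.Ioo (-1) 1) := by
  intro σ hσ τ hτ hστ
  simp only [← tan_arcsin]
  exact tan_lt_tan_of_lt_of_lt_pi_div_two (neg_pi_div_two_lt_arcsin.2 hσ.1)
    (arcsin_lt_pi_div_two.2 hτ.2) (arcsin_lt_arcsin hσ.1.le hστ hτ.2.le)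

lemma strictMonoOn_biTail (c₁ c₂ : ℝ) :
    StrictMonoOn (fun σ => biTail c₁ c₂ σ) (Set.Ioo (-1 : ℝ) 1) := by
  intro σ hσ τ hτ hστ
  have hslope : 0 < τ / √(1 - τ ^ 2) - σ / √(1 - σ ^ 2) :=
    sub_pos.2 (strictMonoOn_div_sqrt_one_sub_sq hσ hτ hστ)
  have hdiff (x : ℝ) : (c₂ - σ * x) / √(1 - σ ^ 2) - (c₂ - τ * x) / √(1 - τ ^ 2) =
      (τ / √(1 - τ ^ 2) - σ / √(1 - σ ^ 2)) * x - (c₂ / √(1 - τ ^ 2) - c₂ / √(1 - σ ^ 2)) := by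
    ring
  simp only [biTail_eq hσ, biTail_eq hτ]
  refine setIntegral_Ioi_lt_of_single_crossing
    (a := (c₂ / √(1 - τ ^ 2) - c₂ / √(1 - σ ^ 2)) / (τ / √(1 - τ ^ 2) - σ / √(1 - σ ^ 2)))
    (integrable_tailDensity hσ c₂) (integrable_tailDensity hτ c₂) ?_
    (fun x hx => ?_) (fun x hx => ?_) c₁
  · rw [integral_tailDensity hσ, integral_tailDensity hτ]
  · rw [div_lt_iff₀' hslope] at hx
    exact mul_lt_mul_of_pos_left (strictAnti_stdTail (by linarith [hdiff x])) (stdPdf_pos x)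
  · rw [lt_div_iff₀' hslope] at hx
    exact mul_lt_mul_of_pos_left (strictAnti_stdTail (by linarith [hdiff x])) (stdPdf_pos x)

/-- For every `σ ∈ (-1,1)`, `ℓ(c₁,c₂;-1) < ℓ(c₁,c₂;σ) < ℓ(c₁,c₂;1)`; in particular
`σ ↦ ℓ(c₁,c₂;σ)` is strictly increasing on `(-1,1)`. -/
theorem biTail_strict_bounds (c₁ c₂ : ℝ) :
    (∀ σ ∈ Set.Ioo (-1 : ℝ) 1,
        biTailNegOne c₁ c₂ < biTail c₁ c₂ σ ∧ biTail c₁ c₂ σ < biTailOne c₁ c₂) ∧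
      StrictMonoOn (fun σ => biTail c₁ c₂ σ) (Set.Ioo (-1 : ℝ) 1) := by
  exact ⟨fun σ hσ => ⟨biTailNegOne_lt_biTail hσ c₁ c₂, biTail_lt_biTailOne hσ c₁ c₂⟩,
    strictMonoOn_biTail c₁ c₂⟩
end

section
/- Let B ∈ ℝ^{p×d} have full column rank d, let H_B = B(BᵀB)^{-1}Bᵀ be the orthogonal projection onto the column space of B, and let H ∈ ℝ^{p×p} be any symmetric idempotent matrix of rank d. Then tr((H_B - H)²) = 2 · tr( Bᵀ(I_p - H)B (BᵀB)^{-1} ) ≤ 2 · λ_min(BᵀB)^{-1} · tr( Bᵀ(I_p - H)B ), where λ_min(BᵀB) > 0 is the smallest eigenvalue of BᵀB. -/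
open Matrix

section TraceLemmas

variable {n : Type*} [Fintype n] [DecidableEq n]

/-- The trace of an idempotent matrix over a field is its rank. -/
lemma Matrix.trace_eq_rank_of_isIdempotentElem {K : Type*} [Field K] {P : Matrix n n K}
    (hP : IsIdempotentElem P) : P.trace = P.rank := by
  have h : IsIdempotentElem P.toLin' := by
    rw [IsIdempotentElem, Module.End.mul_eq_comp, ← Matrix.toLin'_mul, hP.eq]
  rw [← Matrix.trace_toLin'_eq, (LinearMap.IsIdempotentElem.isProj_range _ h).trace]
  rfl

lemma Matrix.IsHermitian.inv_eq_conj_diagonal {A : Matrix n n ℝ} (hA : A.IsHermitian)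
    (h : ∀ i, hA.eigenvalues i ≠ 0) :
    A⁻¹ = (hA.eigenvectorUnitary : Matrix n n ℝ) * diagonal (fun i => (hA.eigenvalues i)⁻¹) *
      star (hA.eigenvectorUnitary : Matrix n n ℝ) := by
  set U := (hA.eigenvectorUnitary : Matrix n n ℝ)
  have hUU : star U * U = 1 := Unitary.coe_star_mul_self _
  have hUU' : U * star U = 1 := Unitary.coe_mul_star_self _
  have hspec : A = U * diagonal hA.eigenvalues * star U := by
    have := hA.spectral_theorem
    rwa [Unitary.conjStarAlgAut_apply] at this
  apply inv_eq_right_inv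
  calc A * (U * diagonal (fun i => (hA.eigenvalues i)⁻¹) * star U)
      = U * diagonal hA.eigenvalues * (star U * U) *
          diagonal (fun i => (hA.eigenvalues i)⁻¹) * star U := by
        refine (congrArg (· * _) hspec).trans ?_
        simp only [mul_assoc]
    _ = 1 := by
        rw [hUU, mul_one, mul_assoc U, diagonal_mul_diagonal]
        simp [h, hUU']

/-- For positive definite `A` and positive semidefinite `M`,
`tr (M A⁻¹) ≤ λ_min(A)⁻¹ tr M`. -/
lemma Matrix.PosSemidef.trace_mul_inv_le {A M : Matrix n n ℝ} (hM : M.PosSemidef)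
    (hA : A.IsHermitian) (hpos : 0 < ⨅ k, hA.eigenvalues k) :
    (M * A⁻¹).trace ≤ (⨅ k, hA.eigenvalues k)⁻¹ * M.trace := by
  have hle (i : n) : ⨅ k, hA.eigenvalues k ≤ hA.eigenvalues i :=
    ciInf_le (Set.finite_range _).bddBelow i
  rw [hA.inv_eq_conj_diagonal fun i => (hpos.trans_le (hle i)).ne']
  set U := (hA.eigenvectorUnitary : Matrix n n ℝ)
  have hUU' : U * star U = 1 := Unitary.coe_mul_star_self _
  have hN : (star U * M * U).PosSemidef := hM.conjTranspose_mul_mul_same U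
  have htr : M.trace = (star U * M * U).trace := by
    rw [trace_mul_comm, ← mul_assoc, hUU', one_mul]
  have htr' : (M * (U * diagonal (fun i => (hA.eigenvalues i)⁻¹) * star U)).trace =
      (star U * M * U * diagonal (fun i => (hA.eigenvalues i)⁻¹)).trace := by
    rw [← mul_assoc, trace_mul_comm]
    simp only [mul_assoc]
  rw [htr, htr', trace, trace, Finset.mul_sum]
  refine Finset.sum_le_sum fun i _ => ?_
  rw [diag_apply, diag_apply, mul_diagonal, mul_comm]
  exact mul_le_mul_of_nonneg_right (inv_anti₀ hpos (hle i)) hN.diag_nonneg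

end TraceLemmas


/-- For `B ∈ ℝ^{p×d}` of full column rank `d ≥ 1`, with `H_B = B(BᵀB)⁻¹Bᵀ` the projection
onto its column space, and `H` any symmetric idempotent matrix of rank `d`:
`λ_min(BᵀB) > 0` and
`tr((H_B - H)²) = 2·tr(Bᵀ(I - H)B(BᵀB)⁻¹) ≤ 2·λ_min(BᵀB)⁻¹·tr(Bᵀ(I - H)B)`. -/
theorem trace_proj_diff_bound (p d : ℕ) (hd : 0 < d)
    (B : Matrix (Fin p) (Fin d) ℝ) (hB : B.rank = d)
    (hBtB : (Bᵀ * B).IsHermitian)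
    (H : Matrix (Fin p) (Fin p) ℝ) (hHsym : Hᵀ = H) (hHidem : H * H = H)
    (hHrank : H.rank = d) :
    0 < (⨅ k, hBtB.eigenvalues k) ∧
    ((B * (Bᵀ * B)⁻¹ * Bᵀ - H) * (B * (Bᵀ * B)⁻¹ * Bᵀ - H)).trace =
      2 * (Bᵀ * (1 - H) * B * (Bᵀ * B)⁻¹).trace ∧
    2 * (Bᵀ * (1 - H) * B * (Bᵀ * B)⁻¹).trace ≤
      2 * (⨅ k, hBtB.eigenvalues k)⁻¹ * (Bᵀ * (1 - H) * B).trace := by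
  have hne : Nonempty (Fin d) := ⟨⟨0, hd⟩⟩
  have hpsd : (Bᵀ * B).PosSemidef := by
    simpa only [conjTranspose_eq_transpose_of_trivial] using posSemidef_conjTranspose_mul_self B
  have heig (i : Fin d) : hBtB.eigenvalues i ≠ 0 := by
    have hcard : Fintype.card {i // hBtB.eigenvalues i ≠ 0} = Fintype.card (Fin d) := by
      rw [← hBtB.rank_eq_card_non_zero_eigs, rank_transpose_mul_self, hB, Fintype.card_fin]
    have hbij := (Fintype.bijective_iff_injective_and_card
      (Subtype.val : {i // hBtB.eigenvalues i ≠ 0} → Fin d)).2 ⟨Subtype.val_injective, hcard⟩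
    obtain ⟨j, rfl⟩ := hbij.2 i
    exact j.2
  have hmin : 0 < ⨅ k, hBtB.eigenvalues k := by
    obtain ⟨i, hi⟩ := exists_eq_ciInf_of_finite (f := hBtB.eigenvalues)
    rw [← hi]
    exact (hpsd.eigenvalues_nonneg i).lt_of_ne' (heig i)
  have hdet : IsUnit (Bᵀ * B).det := by
    rw [hBtB.det_eq_prod_eigenvalues, isUnit_iff_ne_zero]
    exact Finset.prod_ne_zero_iff.2 fun i _ => heig i
  have hMpsd : (Bᵀ * (1 - H) * B).PosSemidef := by
    have hC : Bᵀ * (1 - H) * B = ((1 - H) * B)ᴴ * ((1 - H) * B) := by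
      rw [conjTranspose_eq_transpose_of_trivial, transpose_mul, transpose_sub, transpose_one,
        hHsym, Matrix.mul_assoc, Matrix.mul_assoc, ← Matrix.mul_assoc (1 - H) (1 - H),
        (IsIdempotentElem.one_sub hHidem).eq]
    rw [hC]
    exact posSemidef_conjTranspose_mul_self _
  refine ⟨hmin, ?_, ?_⟩
  · set A := Bᵀ * B with hA
    set P := B * A⁻¹ * Bᵀ with hP
    have hPP : P * P = P := by
      calc P * P = B * A⁻¹ * (Bᵀ * B) * A⁻¹ * Bᵀ := by simp only [hP, Matrix.mul_assoc]
        _ = P := by rw [← hA, Matrix.mul_assoc B, nonsing_inv_mul _ hdet, Matrix.mul_one]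
    have hPtr : P.trace = d := by
      rw [hP, trace_mul_comm, ← Matrix.mul_assoc, ← hA, mul_nonsing_inv _ hdet, trace_one,
        Fintype.card_fin]
    have hHtr : H.trace = d := by
      rw [trace_eq_rank_of_isIdempotentElem hHidem, hHrank]
    have hHP : (Bᵀ * H * B * A⁻¹).trace = (H * P).trace := by
      rw [Matrix.mul_assoc, Matrix.mul_assoc, trace_mul_comm, hP]
      simp only [Matrix.mul_assoc]
    have hR : (Bᵀ * (1 - H) * B * A⁻¹).trace = d - (H * P).trace := by
      rw [Matrix.mul_sub, Matrix.mul_one, Matrix.sub_mul, Matrix.sub_mul, trace_sub, hHP, ← hA,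
        mul_nonsing_inv _ hdet, trace_one, Fintype.card_fin]
    rw [hR, Matrix.sub_mul, Matrix.mul_sub, Matrix.mul_sub, hPP, hHidem, trace_sub, trace_sub,
      trace_sub, hPtr, hHtr, trace_mul_comm P H]
    ring
  · rw [mul_assoc]
    exact mul_le_mul_of_nonneg_left (hMpsd.trace_mul_inv_le hBtB hmin) zero_le_two
end

section
/- Let B ∈ ℝ^{p×d} have full column rank d, let H_B = B(BᵀB)^{-1}Bᵀ and Q_B = I_p - H_B, and let D = diag(τ₁², …, τ_p²) be a diagonal positive semidefinite matrix with max_j τ_j² ≤ τ_max². Then p^{-1} Σ_{j=1}^p | (Q_B D Q_B)_{jj} - τ_j² | ≤ 3 τ_max² d / p. -/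
open Matrix

/-- The Gram matrix of a real matrix of full column rank is invertible. -/
theorem Matrix.isUnit_det_transpose_mul_self {p d : ℕ} {B : Matrix (Fin p) (Fin d) ℝ}
    (hB : B.rank = d) : IsUnit (Bᵀ * B).det := by
  rw [← Matrix.isUnit_iff_isUnit_det, ← Matrix.linearIndependent_cols_iff_isUnit,
    linearIndependent_iff_card_eq_finrank_span, Set.finrank, ← Matrix.rank_eq_finrank_span_cols,
    Matrix.rank_transpose_mul_self, hB, Fintype.card_fin]

/-- Conjugating a diagonal matrix with entries in `[0, M]` by the complement of an orthogonal
projection `H` moves the `j`-th diagonal entry by at most `3 * M * H j j`. -/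
theorem Matrix.abs_diag_residual_sub_le {n : Type*} [Fintype n] [DecidableEq n]
    {H : Matrix n n ℝ} (hsymm : Hᵀ = H) (hidem : H * H = H) {t : n → ℝ} {M : ℝ}
    (ht₀ : ∀ j, 0 ≤ t j) (htM : ∀ j, t j ≤ M) (j : n) :
    |((1 - H) * diagonal t * (1 - H)) j j - t j| ≤ 3 * M * H j j := by
  have hH (i k : n) : H i k = H k i := congrFun₂ hsymm k i
  have hsq : ∑ k, H j k ^ 2 = H j j := by
    conv_rhs => rw [← hidem, mul_apply]
    exact Finset.sum_congr rfl fun k _ => by rw [hH k j, sq]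
  have hdiag : 0 ≤ H j j := hsq ▸ Finset.sum_nonneg fun k _ => sq_nonneg _
  have hentry : ((1 - H) * diagonal t * (1 - H)) j j - t j =
      ∑ k, H j k ^ 2 * t k - 2 * (H j j * t j) := by
    have hexp : (1 - H) * diagonal t * (1 - H) =
        diagonal t - H * diagonal t - diagonal t * H + H * diagonal t * H := by
      noncomm_ring
    have hHDH : (H * diagonal t * H) j j = ∑ k, H j k ^ 2 * t k := by
      rw [mul_apply]
      exact Finset.sum_congr rfl fun k _ => by rw [mul_diagonal, hH k j]; ring
    rw [hexp, add_apply, sub_apply, sub_apply, hHDH, mul_diagonal, diagonal_mul,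
      diagonal_apply_eq]
    ring
  have hsum₀ : 0 ≤ ∑ k, H j k ^ 2 * t k :=
    Finset.sum_nonneg fun k _ => mul_nonneg (sq_nonneg _) (ht₀ k)
  have hsumM : ∑ k, H j k ^ 2 * t k ≤ H j j * M := by
    rw [← hsq, Finset.sum_mul]
    exact Finset.sum_le_sum fun k _ => mul_le_mul_of_nonneg_left (htM k) (sq_nonneg _)
  have hj₀ := mul_nonneg hdiag (ht₀ j)
  have hjM := mul_le_mul_of_nonneg_left (htM j) hdiag
  rw [hentry, abs_le]
  constructor <;> linarith

/-- For `B ∈ ℝ^{p×d}` of full column rank, `Q_B = I - B(BᵀB)⁻¹Bᵀ`, and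
`D = diag(τ₁²,…,τ_p²)` with `max_j τ_j² ≤ τ_max²`:
`p⁻¹ ∑_j |(Q_B D Q_B)_{jj} - τ_j²| ≤ 3 τ_max² d / p`. -/
theorem diag_residual_projection_bound (p d : ℕ)
    (B : Matrix (Fin p) (Fin d) ℝ) (hB : B.rank = d)
    (τ : Fin p → ℝ) (τmax : ℝ) (hτ : ∀ j, τ j ^ 2 ≤ τmax ^ 2) :
    (p : ℝ)⁻¹ * ∑ j : Fin p,
        |(((1 - B * (Bᵀ * B)⁻¹ * Bᵀ) * Matrix.diagonal (fun j => τ j ^ 2) *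
            (1 - B * (Bᵀ * B)⁻¹ * Bᵀ) : Matrix (Fin p) (Fin p) ℝ)) j j - τ j ^ 2| ≤
      3 * τmax ^ 2 * d / p := by
  have hU := Matrix.isUnit_det_transpose_mul_self hB
  set H := B * (Bᵀ * B)⁻¹ * Bᵀ with hHdef
  have hsymm : Hᵀ = H := by
    simp [hHdef, transpose_mul, transpose_nonsing_inv, Matrix.mul_assoc]
  have hidem : H * H = H := by
    calc H * H = B * ((Bᵀ * B)⁻¹ * (Bᵀ * B)) * (Bᵀ * B)⁻¹ * Bᵀ := by
          simp only [hHdef, Matrix.mul_assoc]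
      _ = H := by rw [nonsing_inv_mul _ hU, Matrix.mul_one]
  have htrace : ∑ j, H j j = d := by
    change H.trace = d
    rw [hHdef, trace_mul_comm, ← Matrix.mul_assoc, mul_nonsing_inv _ hU, trace_one,
      Fintype.card_fin]
  rw [div_eq_inv_mul]
  refine mul_le_mul_of_nonneg_left ?_ (by positivity)
  rw [← htrace, Finset.mul_sum]
  exact Finset.sum_le_sum fun j _ =>
    Matrix.abs_diag_residual_sub_le hsymm hidem (fun k => sq_nonneg (τ k)) hτ j
end
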